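/- Let ρ̃ be a finite positive Borel measure on ℝ with compact support contained in [0,∞), with ρ̃({0}) = 0 and ρ̃(ℝ) ≤ 1. Then there exists α ∈ ℓ^{1,∞}_{++} such that for every z ∈ ℂ∖[0,∞): ⟨Γ_α²(Γ_α² − zI)^{-1} e₀, e₀⟩ = ∫ λ/(λ − z) dρ̃(λ). -/

import Mathlib

open scoped ComplexInnerProductSpace ComplexOrder ENNReal NNReal
open MeasureTheory Filter

noncomputable section

abbrev ℓ2 : Type := lp (fun _ : ℕ => ℂ) 2

def e (n : ℕ) : ℓ2 := lp.single 2 n 1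

def IsHankelOp (α : ℕ → ℝ) (Γ : ℓ2 →L[ℂ] ℓ2) : Prop :=
  ∀ n m : ℕ, ⟪Γ (e n), e m⟫ = (α (n + m) : ℂ)

def PosOp (Γ : ℓ2 →L[ℂ] ℓ2) : Prop := ∀ x : ℓ2, 0 ≤ ⟪Γ x, x⟫

def MemL1infPP (α : ℕ → ℝ) (Γ ΓS : ℓ2 →L[ℂ] ℓ2) : Prop :=
  (∃ C : ℝ, ∀ n : ℕ, (n + 1 : ℝ) * |α n| ≤ C) ∧
  IsHankelOp α Γ ∧ IsHankelOp (fun n => α (n + 1)) ΓS ∧ PosOp Γ ∧ PosOp ΓS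

section HilbertSpace

variable {K : Type*} [NormedAddCommGroup K] [InnerProductSpace ℂ K] [CompleteSpace K]

lemma IsSelfAdjoint.denseRange_of_injective {H : K →L[ℂ] K} (hH : IsSelfAdjoint H)
    (hinj : ∀ x, H x = 0 → x = 0) : DenseRange H := by
  have h : H.rangeᗮ = ⊥ := by
    rw [H.orthogonal_range, hH.adjoint_eq]
    exact LinearMap.ker_eq_bot'.2 hinj
  have h2 := Submodule.dense_iff_topologicalClosure_eq_top.2
    (Submodule.topologicalClosure_eq_top_iff.2 h)
  exact h2

/-- Douglas factorization through an operator with dense range. -/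
lemma ContinuousLinearMap.exists_contraction_factor {B C : K →L[ℂ] K} (hC : DenseRange C)
    (h : ∀ x, ‖B x‖ ≤ ‖C x‖) :
    ∃ D : K →L[ℂ] K, (∀ x, D (C x) = B x) ∧ ∀ x, ‖D x‖ ≤ ‖x‖ := by
  have h' : ∀ x, ‖(B : K →ₗ[ℂ] K) x‖ ≤ 1 * ‖(C : K →ₗ[ℂ] K) x‖ := by simpa using h
  refine ⟨(B : K →ₗ[ℂ] K).extendOfNorm (C : K →ₗ[ℂ] K), fun x => ?_, fun x => ?_⟩
  · exact LinearMap.extendOfNorm_eq (f := (B : K →ₗ[ℂ] K)) (e := (C : K →ₗ[ℂ] K)) hC ⟨1, h'⟩ x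
  · simpa using LinearMap.norm_extendOfNorm_apply_le
      (f := (B : K →ₗ[ℂ] K)) (e := (C : K →ₗ[ℂ] K)) hC 1 h' x

lemma inner_pow_mul_pow {A : K →L[ℂ] K} (hA : IsSelfAdjoint A) (n m : ℕ) (x y : K) :
    ⟪(A ^ n) x, (A ^ m) y⟫ = ⟪(A ^ (n + m)) x, y⟫ := by
  have h := (hA.pow m).isSymmetric ((A ^ n) x) y
  have h2 : (A ^ (n + m)) x = (A ^ m) ((A ^ n) x) := by
    rw [add_comm, pow_add]; rfl
  rw [h2]
  exact h.symm

lemma re_inner_pow_nonneg {A : K →L[ℂ] K} (hA : 0 ≤ A) (n : ℕ) (x : K) :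
    0 ≤ (⟪(A ^ n) x, x⟫).re := by
  have h : 0 ≤ A ^ n := CStarAlgebra.pow_nonneg hA n
  exact ((ContinuousLinearMap.nonneg_iff_isPositive _).1 h).re_inner_nonneg_left x

lemma antitone_re_inner_pow {A : K →L[ℂ] K} (hA : 0 ≤ A) (hA1 : A ≤ 1) (x : K) :
    Antitone fun n => (⟪(A ^ n) x, x⟫).re := by
  refine antitone_nat_of_succ_le fun n => ?_
  have h : 0 ≤ A ^ n * (1 - A) :=
    Commute.mul_nonneg (CStarAlgebra.pow_nonneg hA n) (sub_nonneg.2 hA1)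
      ((Commute.one_right _).sub_right (Commute.pow_left (Commute.refl A) n))
  have h2 := ((ContinuousLinearMap.nonneg_iff_isPositive _).1 h).re_inner_nonneg_left x
  rw [mul_sub, mul_one, ← pow_succ, sub_apply, inner_sub_left, map_sub] at h2
  exact sub_nonneg.1 h2

/-- Powers of a positive contraction without the eigenvalue `1` tend strongly to zero. -/
lemma tendsto_pow_apply_zero {A : K →L[ℂ] K} (hA : 0 ≤ A) (hA1 : A ≤ 1)
    (hker : ∀ x, A x = x → x = 0) (x : K) :
    Tendsto (fun n => (A ^ n) x) atTop (nhds 0) := by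
  have hsa : IsSelfAdjoint A := IsSelfAdjoint.of_nonneg hA
  set a : ℕ → ℝ := fun n => (⟪(A ^ n) x, x⟫).re with ha
  have hlim : Tendsto a atTop (nhds (⨅ i, a i)) :=
    tendsto_atTop_ciInf (antitone_re_inner_pow hA hA1 x)
      ⟨0, by rintro _ ⟨n, rfl⟩; exact re_inner_pow_nonneg hA n x⟩
  have hdist : ∀ n m, ‖(A ^ n) x - (A ^ m) x‖ ^ 2 = a (n + n) - 2 * a (n + m) + a (m + m) := by
    intro n m
    rw [@norm_sub_sq ℂ, ← @inner_self_eq_norm_sq ℂ, ← @inner_self_eq_norm_sq ℂ,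
      inner_pow_mul_pow hsa, inner_pow_mul_pow hsa, inner_pow_mul_pow hsa]
    rfl
  have hcau : CauchySeq fun n => (A ^ n) x := by
    rw [Metric.cauchySeq_iff']
    intro ε hε
    obtain ⟨N, hN⟩ := Metric.tendsto_atTop.1 hlim (ε ^ 2 / 4) (by positivity)
    refine ⟨N, fun n hn => ?_⟩
    have h1 := abs_lt.1 (hN (n + n) (by omega))
    have h2 := abs_lt.1 (hN (n + N) (by omega))
    have h3 := abs_lt.1 (hN (N + N) (by omega))
    rw [dist_eq_norm]
    refine lt_of_pow_lt_pow_left₀ 2 hε.le ?_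
    rw [hdist]
    linarith [h1.2, h2.1, h3.2]
  obtain ⟨y, hy⟩ := cauchySeq_tendsto_of_complete hcau
  have h1 : Tendsto (fun n => (A ^ (n + 1)) x) atTop (nhds (A y)) := by
    have := (A.continuous.tendsto y).comp hy
    refine this.congr fun n => ?_
    rw [pow_succ']; rfl
  have h2 := tendsto_nhds_unique h1 (hy.comp (tendsto_add_atTop_nat 1))
  rwa [hker y h2] at hy

lemma sq_sub_rankOne_nonneg {H : K →L[ℂ] K} (hH : IsSelfAdjoint H) {q : K} (hq : ‖q‖ ≤ 1) :
    0 ≤ H ^ 2 - InnerProductSpace.rankOne ℂ (H q) (H q) := by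
  rw [ContinuousLinearMap.nonneg_iff_isPositive, ContinuousLinearMap.isPositive_def']
  refine ⟨(hH.pow 2).sub
    (InnerProductSpace.isPositive_rankOne_self (𝕜 := ℂ) (H q)).isSelfAdjoint, fun x => ?_⟩
  have h1 : (⟪(H ^ 2) x, x⟫).re = ‖H x‖ ^ 2 := by
    rw [pow_two, mul_apply_eq_comp, ← @inner_self_eq_norm_sq ℂ]
    exact congrArg Complex.re (hH.isSymmetric (H x) x)
  have h2 : ‖⟪H q, x⟫‖ ≤ ‖H x‖ := by
    rw [show ⟪H q, x⟫ = ⟪q, H x⟫ from hH.isSymmetric q x]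
    exact (norm_inner_le_norm _ _).trans (mul_le_of_le_one_left (norm_nonneg _) hq)
  rw [ContinuousLinearMap.reApplyInnerSelf_apply, sub_apply, inner_sub_left, map_sub,
    InnerProductSpace.inner_left_rankOne_apply, ← inner_conj_symm x (H q), Complex.conj_mul']
  norm_cast
  rw [sub_nonneg]
  exact (pow_le_pow_left₀ (norm_nonneg _) h2 2).trans_eq h1.symm

/-- The data of the Hankel model: `H₁ = √(H² - ⟨·, Hq⟩Hq)`, the contraction `T` with
`T H = H₁ = H T†`, and its symmetrization `A` through `P = √H`. -/
lemma exists_hankel_model {H : K →L[ℂ] K} {q : K} (hH : 0 ≤ H)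
    (hinj : ∀ x, H x = 0 → x = 0) (hq : ‖q‖ ≤ 1)
    (hcyc : ∀ f, (∀ n : ℕ, ⟪q, (H ^ n) f⟫ = 0) → f = 0) :
    ∃ H₁ T P A : K →L[ℂ] K, 0 ≤ H₁ ∧ 0 ≤ A ∧ A ≤ 1 ∧ IsSelfAdjoint P ∧
      (∀ x, P (P x) = H x) ∧ (∀ x, T (H x) = H₁ x) ∧ (∀ x, H (T.adjoint x) = H₁ x) ∧
      (∀ (n : ℕ) x, (T ^ n) (P x) = P ((A ^ n) x)) ∧
      (∀ f, ‖f‖ ^ 2 = ‖⟪q, f⟫‖ ^ 2 + ‖T f‖ ^ 2) ∧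
      ∀ f, Tendsto (fun n => (T ^ n) f) atTop (nhds 0) := by
  have hHsa : IsSelfAdjoint H := IsSelfAdjoint.of_nonneg hH
  have hHd : DenseRange H := hHsa.denseRange_of_injective hinj
  set S := H ^ 2 - InnerProductSpace.rankOne ℂ (H q) (H q) with hS
  have hS0 : 0 ≤ S := sq_sub_rankOne_nonneg hHsa hq
  set H₁ := CFC.sqrt S with hH₁
  have hH₁0 : 0 ≤ H₁ := CFC.sqrt_nonneg S
  have hH₁sa : IsSelfAdjoint H₁ := IsSelfAdjoint.of_nonneg hH₁0
  have hH₁H : H₁ ≤ H := by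
    rw [← CFC.sqrt_sq H]
    refine CFC.sqrt_le_sqrt _ _ (sub_le_self _ ?_)
    rw [ContinuousLinearMap.nonneg_iff_isPositive]
    exact InnerProductSpace.isPositive_rankOne_self (𝕜 := ℂ) (H q)
  have hnorm : ∀ {B : K →L[ℂ] K}, IsSelfAdjoint B → ∀ x, ‖B x‖ ^ 2 = (⟪(B * B) x, x⟫).re := by
    intro B hB x
    rw [← @inner_self_eq_norm_sq ℂ]
    exact congrArg Complex.re (hB.isSymmetric (B x) x).symm
  have hH₁norm : ∀ x, ‖H x‖ ^ 2 = ‖⟪q, H x⟫‖ ^ 2 + ‖H₁ x‖ ^ 2 := by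
    intro x
    rw [hnorm hHsa, hnorm hH₁sa, CFC.sqrt_mul_sqrt_self S, hS, sub_apply, inner_sub_left,
      InnerProductSpace.inner_left_rankOne_apply, ← inner_conj_symm x (H q), Complex.conj_mul',
      show ⟪H q, x⟫ = ⟪q, H x⟫ from hHsa.isSymmetric q x, Complex.sub_re, ← pow_two]
    norm_cast
    ring
  obtain ⟨T, hT, hTc⟩ := ContinuousLinearMap.exists_contraction_factor (B := H₁) hHd
    (fun x => le_of_sq_le_sq (by rw [hH₁norm x]; nlinarith [sq_nonneg ‖⟪q, H x⟫‖])
      (norm_nonneg _))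
  have hTnorm : ∀ f, ‖f‖ ^ 2 = ‖⟪q, f⟫‖ ^ 2 + ‖T f‖ ^ 2 := by
    intro f
    refine hHd.induction_on (p := fun f => ‖f‖ ^ 2 = ‖⟪q, f⟫‖ ^ 2 + ‖T f‖ ^ 2) f ?_ ?_
    · exact isClosed_eq (by fun_prop) (by fun_prop)
    · intro x
      rw [hT, hH₁norm]
  set P := CFC.sqrt H with hP
  have hPsa : IsSelfAdjoint P := IsSelfAdjoint.of_nonneg (CFC.sqrt_nonneg H)
  have hPP : P * P = H := CFC.sqrt_mul_sqrt_self H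
  have hPP' : ∀ x, P (P x) = H x := fun x => by rw [← hPP]; rfl
  have hPinj : ∀ x, P x = 0 → x = 0 := fun x hx => hinj x (by rw [← hPP', hx, map_zero])
  have hPd : DenseRange P := hPsa.denseRange_of_injective hPinj
  set R := CFC.sqrt H₁ with hR
  have hRsa : IsSelfAdjoint R := IsSelfAdjoint.of_nonneg (CFC.sqrt_nonneg H₁)
  have hRR : R * R = H₁ := CFC.sqrt_mul_sqrt_self H₁
  obtain ⟨D, hD, hDc⟩ := ContinuousLinearMap.exists_contraction_factor (B := R) hPd (fun x => by
    refine le_of_sq_le_sq ?_ (norm_nonneg _)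
    rw [hnorm hRsa, hnorm hPsa, hRR, hPP]
    have := ((ContinuousLinearMap.le_def _ _).1 hH₁H).re_inner_nonneg_left x
    rw [sub_apply, inner_sub_left, map_sub] at this
    exact sub_nonneg.1 this)
  set A := D.adjoint * D with hA
  have hAin : ∀ x y, ⟪A x, y⟫ = ⟪D x, D y⟫ := fun x y => D.adjoint_inner_left _ _
  have hA0 : 0 ≤ A := star_mul_self_nonneg D
  have hA1 : A ≤ 1 := by
    rw [ContinuousLinearMap.le_def, ContinuousLinearMap.isPositive_def']
    refine ⟨(IsSelfAdjoint.one _).sub (IsSelfAdjoint.of_nonneg hA0), fun x => ?_⟩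
    rw [ContinuousLinearMap.reApplyInnerSelf_apply, sub_apply, inner_sub_left, map_sub, hAin,
      one_apply_eq_self, inner_self_eq_norm_sq, inner_self_eq_norm_sq, sub_nonneg]
    gcongr
    exact hDc x
  have hPAP : ∀ x, P (A (P x)) = H₁ x := by
    intro x
    refine ext_inner_right ℂ fun y => ?_
    rw [show ⟪P (A (P x)), y⟫ = ⟪A (P x), P y⟫ from hPsa.isSymmetric _ _, hAin, hD, hD, ← hRR]
    exact (hRsa.isSymmetric _ _).symm
  have hTP : ∀ x, T (P x) = P (A x) := by
    intro x
    refine hPd.induction_on (p := fun x => T (P x) = P (A x)) x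
      (isClosed_eq (by fun_prop) (by fun_prop)) fun x => ?_
    rw [hPP', hT, hPAP]
  have hTH : ∀ x, H (T.adjoint x) = H₁ x := by
    intro x
    refine ext_inner_right ℂ fun y => ?_
    rw [show ⟪H (T.adjoint x), y⟫ = ⟪T.adjoint x, H y⟫ from hHsa.isSymmetric _ _,
      T.adjoint_inner_left, hT]
    exact (hH₁sa.isSymmetric _ _).symm
  have hfix : ∀ f, T f = f → T (H f) = H f := by
    intro f hf
    have h1 : T.adjoint f = f := by
      have hle : ‖T.adjoint f‖ ≤ ‖f‖ := by
        refine (T.adjoint.le_opNorm f).trans (mul_le_of_le_one_left (norm_nonneg _) ?_)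
        rw [LinearIsometryEquiv.norm_map]
        exact T.opNorm_le_bound zero_le_one (by simpa using hTc)
      have h2 : ‖T.adjoint f - f‖ ^ 2 ≤ 0 := by
        rw [@norm_sub_sq ℂ, T.adjoint_inner_left, hf, inner_self_eq_norm_sq]
        nlinarith [norm_nonneg (T.adjoint f)]
      exact sub_eq_zero.1 (norm_eq_zero.1 (pow_eq_zero_iff two_ne_zero |>.1
        (le_antisymm h2 (sq_nonneg _))))
    rw [hT, ← hTH, h1]
  have hfix0 : ∀ f, T f = f → f = 0 := by
    intro f hf
    have hn : ∀ n : ℕ, T ((H ^ n) f) = (H ^ n) f := by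
      intro n
      induction n with
      | zero => simpa using hf
      | succ n ih =>
        rw [pow_succ', mul_apply_eq_comp]
        exact hfix _ ih
    refine hcyc f fun n => ?_
    have := hTnorm ((H ^ n) f)
    rw [hn] at this
    simpa using this
  have hApow := tendsto_pow_apply_zero hA0 hA1
    fun x hx => hPinj x (hfix0 _ (by rw [hTP, hx]))
  have hTpow : ∀ (n : ℕ) x, (T ^ n) (P x) = P ((A ^ n) x) := by
    intro n x
    induction n with
    | zero => simp
    | succ n ih => rw [pow_succ', mul_apply_eq_comp, ih, hTP, pow_succ' A]; rfl
  have hTnc : ∀ (n : ℕ) x, ‖(T ^ n) x‖ ≤ ‖x‖ := by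
    intro n x
    induction n with
    | zero => simp
    | succ n ih =>
      rw [pow_succ', mul_apply_eq_comp]
      exact (hTc _).trans ih
  refine ⟨H₁, T, P, A, hH₁0, hA0, hA1, hPsa, hPP', hT, hTH, hTpow, hTnorm, fun f => ?_⟩
  rw [Metric.tendsto_atTop]
  intro ε hε
  obtain ⟨x, hx⟩ := hPd.exists_dist_lt f (half_pos hε)
  have hlim : Tendsto (fun n => P ((A ^ n) x)) atTop (nhds 0) := by
    have := (P.continuous.tendsto 0).comp (hApow x)
    rwa [map_zero] at this
  obtain ⟨N, hN⟩ := Metric.tendsto_atTop.1 hlim (ε / 2) (half_pos hε)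
  refine ⟨N, fun n hn => ?_⟩
  have h1 := hN n hn
  have h2 := hTnc n (f - P x)
  rw [dist_zero_right] at h1 ⊢
  rw [dist_eq_norm] at hx
  rw [map_sub, hTpow] at h2
  have h3 := norm_add_le ((T ^ n) f - P ((A ^ n) x)) (P ((A ^ n) x))
  rw [sub_add_cancel] at h3
  linarith

end HilbertSpace

lemma exists_linearIsometry_orbit {K : Type*} [NormedAddCommGroup K] [InnerProductSpace ℂ K]
    {T : K →L[ℂ] K} {q : K}
    (hT : ∀ f, ‖f‖ ^ 2 = ‖⟪q, f⟫‖ ^ 2 + ‖T f‖ ^ 2)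
    (hlim : ∀ f, Tendsto (fun n => (T ^ n) f) atTop (nhds 0)) :
    ∃ W : K →ₗᵢ[ℂ] ℓ2, ∀ f n, (W f : ∀ _, ℂ) n = ⟪q, (T ^ n) f⟫ := by
  have hsum : ∀ f, HasSum (fun n => ‖⟪q, (T ^ n) f⟫‖ ^ 2) (‖f‖ ^ 2) := by
    intro f
    rw [hasSum_iff_tendsto_nat_of_nonneg (fun n => sq_nonneg _)]
    have h1 : ∀ n : ℕ, ∑ i ∈ Finset.range n, ‖⟪q, (T ^ i) f⟫‖ ^ 2
        = ‖f‖ ^ 2 - ‖(T ^ n) f‖ ^ 2 := by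
      intro n
      induction n with
      | zero => simp
      | succ n ih =>
        rw [Finset.sum_range_succ, ih, hT ((T ^ n) f), pow_succ' T, mul_apply_eq_comp]
        ring
    have h2 := ((hlim f).norm.pow 2).const_sub (‖f‖ ^ 2)
    rw [norm_zero, zero_pow two_ne_zero, sub_zero] at h2
    exact h2.congr fun n => (h1 n).symm
  have hmem : ∀ f, Memℓp (fun n : ℕ => ⟪q, (T ^ n) f⟫) 2 := by
    intro f
    refine memℓp_gen ?_
    simpa using (hsum f).summable
  refine ⟨⟨{ toFun := fun f => ⟨fun n => ⟪q, (T ^ n) f⟫, hmem f⟩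
             map_add' := fun f g => ?_
             map_smul' := fun c f => ?_ }, fun f => ?_⟩, fun f n => rfl⟩
  · ext n
    exact (congrArg _ (map_add (T ^ n) f g)).trans (inner_add_right _ _ _)
  · ext n
    exact (congrArg _ (map_smul (T ^ n) c f)).trans (inner_smul_right _ _ _)
  · have h := lp.norm_rpow_eq_tsum (p := 2) (by norm_num)
      (⟨fun n => ⟪q, (T ^ n) f⟫, hmem f⟩ : ℓ2)
    simp only [ENNReal.toReal_ofNat, Real.rpow_two] at h
    rw [(hsum f).tsum_eq] at h
    exact (sq_eq_sq₀ (norm_nonneg _) (norm_nonneg _)).1 h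

lemma inner_e_left (n : ℕ) (x : ℓ2) : ⟪e n, x⟫ = (x : ∀ _, ℂ) n := by
  rw [e, lp.inner_single_left]
  simp

lemma inner_e_e (n m : ℕ) : ⟪e n, e m⟫ = if n = m then 1 else 0 := by
  rw [inner_e_left, e, lp.single_apply]
  split_ifs with h <;> aesop

/-- A bounded Hankel operator with nonnegative nonincreasing entries has entries `O(1/n)`. -/
lemma IsHankelOp.mul_le_of_antitone {α : ℕ → ℝ} {Γ : ℓ2 →L[ℂ] ℓ2} (h : IsHankelOp α Γ)
    (hanti : Antitone α) (hnn : ∀ n, 0 ≤ α n) (n : ℕ) : (n + 1 : ℝ) * |α n| ≤ 2 * ‖Γ‖ := by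
  have key : ∀ n : ℕ, (n + 1 : ℝ) * α (2 * n) ≤ ‖Γ‖ := by
    intro n
    set s := Finset.range (n + 1)
    set x : ℓ2 := ∑ k ∈ s, e k with hx
    have hxn : ‖x‖ ^ 2 = n + 1 := by
      have : ((‖x‖ ^ 2 : ℝ) : ℂ) = n + 1 := by
        push_cast
        refine (inner_self_eq_norm_sq_to_K (𝕜 := ℂ) x).symm.trans ?_
        rw [hx, sum_inner]
        simp only [inner_sum, inner_e_e, Finset.sum_ite_eq, Finset.sum_ite_mem,
          Finset.inter_self]
        simp [s]
      exact_mod_cast this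
    have hin : ⟪Γ x, x⟫ = ((∑ j ∈ s, ∑ k ∈ s, α (j + k) : ℝ) : ℂ) := by
      rw [hx, map_sum, sum_inner]
      simp only [inner_sum, h _ _]
      push_cast
      rfl
    have hle : ∑ j ∈ s, ∑ k ∈ s, α (j + k) ≤ ‖Γ‖ * (n + 1) := by
      rw [← hxn]
      calc ∑ j ∈ s, ∑ k ∈ s, α (j + k) ≤ ‖⟪Γ x, x⟫‖ := by
            rw [hin, Complex.norm_real]; exact Real.le_norm_self _
        _ ≤ ‖Γ x‖ * ‖x‖ := norm_inner_le_norm _ _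
        _ ≤ ‖Γ‖ * ‖x‖ * ‖x‖ := by gcongr; exact Γ.le_opNorm x
        _ = ‖Γ‖ * ‖x‖ ^ 2 := by ring
    have hge : (n + 1 : ℝ) * ((n + 1) * α (2 * n)) ≤ ∑ j ∈ s, ∑ k ∈ s, α (j + k) := by
      have : ∑ j ∈ s, ∑ k ∈ s, α (2 * n) ≤ ∑ j ∈ s, ∑ k ∈ s, α (j + k) := by
        refine Finset.sum_le_sum fun j hj => Finset.sum_le_sum fun k hk => hanti ?_
        have := Finset.mem_range.1 hj
        have := Finset.mem_range.1 hk
        omega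
      simpa [s] using this
    have hpos : (0 : ℝ) < n + 1 := by positivity
    nlinarith
  rw [abs_of_nonneg (hnn n)]
  have h1 := key (n / 2)
  have h2 : α n ≤ α (2 * (n / 2)) := hanti (by omega)
  have h3 : (n + 1 : ℝ) ≤ 2 * ((n / 2 : ℕ) + 1) := by
    norm_cast
    omega
  calc (n + 1 : ℝ) * α n ≤ 2 * ((n / 2 : ℕ) + 1) * α (2 * (n / 2)) := by
        gcongr
        exact hnn n
    _ ≤ 2 * ‖Γ‖ := by linarith

lemma PosOp.nonneg {Γ : ℓ2 →L[ℂ] ℓ2} (h : PosOp Γ) : 0 ≤ Γ := by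
  rw [ContinuousLinearMap.nonneg_iff_isPositive, ContinuousLinearMap.isPositive_iff_complex]
  intro x
  obtain ⟨h1, h2⟩ := Complex.nonneg_iff.1 (h x)
  exact ⟨Complex.ext rfl h2, h1⟩

/-- Every cyclic positive model `(H, q)` with `‖q‖ ≤ 1` is realized by a Hankel operator. -/
lemma exists_hankel_of_cyclic {K : Type*} [NormedAddCommGroup K] [InnerProductSpace ℂ K]
    [CompleteSpace K] {H : K →L[ℂ] K} {q : K} (hH : 0 ≤ H)
    (hinj : ∀ x, H x = 0 → x = 0) (hq : ‖q‖ ≤ 1)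
    (hcyc : ∀ f, (∀ n : ℕ, ⟪q, (H ^ n) f⟫ = 0) → f = 0) :
    ∃ (α : ℕ → ℝ) (Γ ΓS : ℓ2 →L[ℂ] ℓ2), MemL1infPP α Γ ΓS ∧
      ∀ z : ℂ, (∀ t : ℝ, 0 ≤ t → z ≠ (t : ℂ)) → ∀ v : K, H (H v) - z • v = q →
        ⟪e 0, (Γ ^ 2 * Ring.inverse (Γ ^ 2 - z • 1) : ℓ2 →L[ℂ] ℓ2) (e 0)⟫ =
          ⟪q, H (H v)⟫ := by
  obtain ⟨H₁, T, P, A, hH₁, hA0, hA1, hP, hPP, hTH, hHT, hTP, hTn, hlim⟩ :=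
    exists_hankel_model hH hinj hq hcyc
  obtain ⟨W, hW⟩ := exists_linearIsometry_orbit hTn hlim
  set Wc : K →L[ℂ] ℓ2 := W.toContinuousLinearMap with hWc
  have hWW : ∀ x, Wc.adjoint (Wc x) = x := by
    intro x
    refine ext_inner_right ℂ fun y => ?_
    rw [Wc.adjoint_inner_left]
    exact W.inner_map_map x y
  have hWe : ∀ n f, ⟪Wc.adjoint (e n), f⟫ = ⟪q, (T ^ n) f⟫ := by
    intro n f
    rw [Wc.adjoint_inner_left, inner_e_left]
    exact hW f n
  have hWe0 : Wc.adjoint (e 0) = q := ext_inner_right ℂ fun f => by rw [hWe]; simp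
  have hWes : ∀ n, Wc.adjoint (e (n + 1)) = T.adjoint (Wc.adjoint (e n)) := by
    intro n
    refine ext_inner_right ℂ fun f => ?_
    rw [hWe, T.adjoint_inner_left, hWe, pow_succ, mul_apply_eq_comp]
  have hHW : ∀ n, H (Wc.adjoint (e n)) = (T ^ n) (H q) := by
    intro n
    induction n with
    | zero => simp [hWe0]
    | succ n ih => rw [hWes, hHT, ← hTH, ih, pow_succ', mul_apply_eq_comp]
  set α : ℕ → ℝ := fun n => (⟪(A ^ n) (P q), P q⟫).re with hα
  have hαin : ∀ n m, ⟪H (Wc.adjoint (e n)), Wc.adjoint (e m)⟫ = (α (n + m) : ℂ) := by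
    intro n m
    have hsym := (((ContinuousLinearMap.nonneg_iff_isPositive _).1
      (CStarAlgebra.pow_nonneg hA0 (n + m))).inner_nonneg_left (P q))
    have h1 : ⟪(T ^ (n + m)) (H q), q⟫ = (α (n + m) : ℂ) := by
      rw [← hPP, hTP, show ⟪P ((A ^ (n + m)) (P q)), q⟫ = ⟪(A ^ (n + m)) (P q), P q⟫ from
        hP.isSymmetric _ _]
      exact Complex.ext rfl (Complex.nonneg_iff.1 hsym).2.symm
    rw [hHW, ← inner_conj_symm, hWe, inner_conj_symm, ← mul_apply_eq_comp, ← pow_add, add_comm m n]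
    exact h1
  set Γ : ℓ2 →L[ℂ] ℓ2 := Wc ∘L H ∘L Wc.adjoint with hΓ
  set ΓS : ℓ2 →L[ℂ] ℓ2 := Wc ∘L H₁ ∘L Wc.adjoint with hΓS
  have hin : ∀ (B : K →L[ℂ] K) x y,
      ⟪(Wc ∘L B ∘L Wc.adjoint) x, y⟫ = ⟪B (Wc.adjoint x), Wc.adjoint y⟫ := fun B x y =>
    (Wc.adjoint_inner_right _ _).symm
  have hpos : ∀ B : K →L[ℂ] K, 0 ≤ B → PosOp (Wc ∘L B ∘L Wc.adjoint) := by
    intro B hB x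
    rw [hin]
    exact ((ContinuousLinearMap.nonneg_iff_isPositive _).1 hB).inner_nonneg_left _
  have hHank : IsHankelOp α Γ := fun n m => by rw [hΓ, hin, hαin]
  have hHankS : IsHankelOp (fun n => α (n + 1)) ΓS := fun n m => by
    rw [hΓS, hin, ← hHT, ← hWes, hαin, add_right_comm]
  refine ⟨α, Γ, ΓS, ⟨⟨2 * ‖Γ‖, hHank.mul_le_of_antitone (antitone_re_inner_pow hA0 hA1 _)
    fun n => re_inner_pow_nonneg hA0 n _⟩, hHank, hHankS, hpos H hH, hpos H₁ hH₁⟩, ?_⟩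
  intro z hz v hv
  have hΓ0 : 0 ≤ Γ := (hpos H hH).nonneg
  have hΓ2 : 0 ≤ Γ ^ 2 := CStarAlgebra.pow_nonneg hΓ0 2
  have hunit : IsUnit (Γ ^ 2 - z • 1) := by
    have hns : z ∉ spectrum ℂ (Γ ^ 2) := by
      intro hmem
      obtain ⟨h1, h2⟩ := Complex.nonneg_iff.1 (spectrum_nonneg_of_nonneg hΓ2 hmem)
      exact hz z.re h1 (Complex.ext rfl h2.symm)
    have := (spectrum.notMem_iff.1 hns).neg
    rwa [neg_sub, Algebra.algebraMap_eq_smul_one] at this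
  have hcomm : Commute (Γ ^ 2) (Ring.inverse (Γ ^ 2 - z • 1)) := by
    have h := (Commute.refl (Γ ^ 2)).sub_right ((Commute.one_right (Γ ^ 2)).smul_right z)
    obtain ⟨u, hu⟩ := hunit
    rw [← hu] at h ⊢
    rw [Ring.inverse_unit]
    exact h.units_inv_right
  have hΓW : ∀ x, Γ (Wc x) = Wc (H x) := fun x => congrArg (fun y => Wc (H y)) (hWW x)
  have hΓe : (Γ ^ 2) (e 0) = (Γ ^ 2 - z • 1 : ℓ2 →L[ℂ] ℓ2) (Wc (H (H v))) := by
    have h1 : Γ (e 0) = Wc (H q) := congrArg (fun y => Wc (H y)) hWe0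
    rw [pow_two, mul_apply_eq_comp, h1, hΓW, sub_apply, mul_apply_eq_comp, hΓW, hΓW, ← hv]
    simp
  rw [hcomm.eq, mul_apply_eq_comp, hΓe, ← mul_apply_eq_comp, Ring.inverse_mul_cancel _ hunit,
    one_apply_eq_self, ← Wc.adjoint_inner_left, hWe0]

lemma exists_mul_operator {ρ : Measure ℝ} {φ : ℝ → ℂ} (hφ : MemLp φ ∞ ρ) :
    ∃ M : Lp ℂ 2 ρ →L[ℂ] Lp ℂ 2 ρ, ∀ f, M f =ᵐ[ρ] fun x => φ x * f x := by
  refine ⟨(ContinuousLinearMap.mul ℂ ℂ).holderL ρ ∞ 2 2 hφ.toLp, fun f => ?_⟩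
  rw [ContinuousLinearMap.holderL_apply_apply]
  refine (ContinuousLinearMap.coeFn_holder _ _ _).trans ?_
  filter_upwards [hφ.coeFn_toLp] with x hx
  rw [hx]
  rfl

lemma memLp_top_of_continuousOn_Icc {ρ : Measure ℝ} {C : ℝ} {φ : ℝ → ℂ}
    (hsupp : ρ (Set.Icc (0 : ℝ) C)ᶜ = 0) (hφ : Measurable φ)
    (hc : ContinuousOn φ (Set.Icc 0 C)) : MemLp φ ∞ ρ := by
  obtain ⟨B, hB⟩ := isCompact_Icc.exists_bound_of_continuousOn hc
  refine memLp_top_of_bound hφ.aestronglyMeasurable B ?_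
  filter_upwards [mem_ae_iff.2 hsupp] with x hx using hB x hx

/-- A compactly supported complex density is determined by its moments. -/
lemma ae_eq_zero_of_integral_pow_mul_eq_zero {ρ : Measure ℝ} [IsFiniteMeasure ρ] {C : ℝ}
    (hsupp : ρ (Set.Icc (0 : ℝ) C)ᶜ = 0) {f : ℝ → ℂ} (hf : Integrable f ρ)
    (h : ∀ n : ℕ, ∫ x, (x : ℂ) ^ n * f x ∂ρ = 0) : f =ᵐ[ρ] 0 := by
  have hint : ∀ g : ℝ → ℝ, Continuous g → Integrable (fun x => (g x : ℂ) * f x) ρ := by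
    intro g hg
    have hg' : Continuous fun x => (g x : ℂ) := Complex.continuous_ofReal.comp hg
    obtain ⟨B, hB⟩ := (isCompact_Icc (a := (0 : ℝ)) (b := C)).exists_bound_of_continuousOn
      hg'.continuousOn
    refine hf.bdd_mul (c := B) hg'.aestronglyMeasurable ?_
    filter_upwards [mem_ae_iff.2 hsupp] with x hx using hB x hx
  have hpoly : ∀ p : Polynomial ℝ, ∫ x, ((p.eval x : ℝ) : ℂ) * f x ∂ρ = 0 := by
    intro p
    simp only [Polynomial.eval_eq_sum_range, Complex.ofReal_sum, Finset.sum_mul]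
    rw [integral_finsetSum]
    · refine Finset.sum_eq_zero fun n _ => ?_
      simp only [Complex.ofReal_mul, Complex.ofReal_pow, mul_assoc]
      rw [integral_const_mul, h, mul_zero]
    · intro n _
      exact hint _ (by fun_prop)
  have hcont : ∀ g : ℝ → ℝ, Continuous g → ∫ x, (g x : ℂ) * f x ∂ρ = 0 := by
    intro g hg
    refine norm_le_zero_iff.1 (le_of_forall_pos_le_add fun ε hε => ?_)
    set I := ∫ x, ‖f x‖ ∂ρ with hI
    have hI0 : 0 ≤ I := integral_nonneg fun x => norm_nonneg _
    obtain ⟨p, hp⟩ := exists_polynomial_near_of_continuousOn 0 C g hg.continuousOn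
      (ε / (I + 1)) (by positivity)
    have h1 : ∫ x, (g x : ℂ) * f x ∂ρ = ∫ x, ((g x : ℂ) * f x - (p.eval x : ℝ) * f x) ∂ρ := by
      rw [integral_sub (hint g hg) (hint _ p.continuous), hpoly, sub_zero]
    rw [h1, zero_add]
    calc ‖∫ x, ((g x : ℂ) * f x - (p.eval x : ℝ) * f x) ∂ρ‖
        ≤ ∫ x, ε / (I + 1) * ‖f x‖ ∂ρ := by
          refine norm_integral_le_of_norm_le (hf.norm.const_mul _) ?_
          filter_upwards [mem_ae_iff.2 hsupp] with x hx
          rw [← sub_mul, norm_mul, ← Complex.ofReal_sub, Complex.norm_real, Real.norm_eq_abs,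
            abs_sub_comm]
          gcongr
          exact (hp x hx).le
      _ = ε / (I + 1) * I := by rw [integral_const_mul]
      _ ≤ ε := by
          rw [div_mul_eq_mul_div, div_le_iff₀ (by positivity)]
          nlinarith
  refine ae_eq_zero_of_integral_contDiff_smul_eq_zero hf.locallyIntegrable fun g hg _ => ?_
  simpa using hcont g hg.continuous

theorem statement17 (ρ : MeasureTheory.Measure ℝ)
    (hfin : MeasureTheory.IsFiniteMeasure ρ)
    (hsupp : ∃ C : ℝ, 0 ≤ C ∧ ρ (Set.Icc (0 : ℝ) C)ᶜ = 0)
    (h0 : ρ {0} = 0) (h1 : ρ Set.univ ≤ 1) :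
    ∃ (α : ℕ → ℝ) (Γ ΓS : ℓ2 →L[ℂ] ℓ2), MemL1infPP α Γ ΓS ∧
      ∀ z : ℂ, (∀ t : ℝ, 0 ≤ t → z ≠ (t : ℂ)) →
        ⟪e 0, (Γ ^ 2 * Ring.inverse (Γ ^ 2 - z • 1) : ℓ2 →L[ℂ] ℓ2) (e 0)⟫ =
          ∫ l, (l : ℂ) / ((l : ℂ) - z) ∂ρ := by
  obtain ⟨C, -, hC⟩ := hsupp
  have hnn : ∀ᵐ x ∂ρ, 0 ≤ x := by
    filter_upwards [mem_ae_iff.2 hC] with x hx using hx.1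
  have hne : ∀ᵐ x ∂ρ, x ≠ 0 := by
    rw [ae_iff]
    simpa using h0
  have hφ : Continuous fun x : ℝ => ((√x : ℝ) : ℂ) :=
    Complex.continuous_ofReal.comp Real.continuous_sqrt
  obtain ⟨H, hH⟩ := exists_mul_operator
    (memLp_top_of_continuousOn_Icc hC hφ.measurable hφ.continuousOn)
  set q : Lp ℂ 2 ρ := (memLp_const (1 : ℂ)).toLp with hq
  have hqc : q =ᵐ[ρ] fun _ => 1 := MemLp.coeFn_toLp _
  have hqin : ∀ f : Lp ℂ 2 ρ, ⟪q, f⟫ = ∫ x, f x ∂ρ := by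
    intro f
    rw [L2.inner_def]
    refine integral_congr_ae ?_
    filter_upwards [hqc] with x hx
    simp [hx]
  have hq1 : ‖q‖ ≤ 1 := by
    have h2 : ‖q‖ ^ 2 = ρ.real Set.univ := by
      have : ((‖q‖ ^ 2 : ℝ) : ℂ) = ρ.real Set.univ := by
        push_cast
        refine (inner_self_eq_norm_sq_to_K (𝕜 := ℂ) q).symm.trans ?_
        rw [hqin, integral_congr_ae hqc]
        simp
      exact_mod_cast this
    have h3 : ρ.real Set.univ ≤ 1 := ENNReal.toReal_le_of_le_ofReal zero_le_one (by simpa using h1)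
    exact le_of_sq_le_sq (by rw [h2]; simpa using h3) zero_le_one
  have hHpos : 0 ≤ H := by
    rw [ContinuousLinearMap.nonneg_iff_isPositive, ContinuousLinearMap.isPositive_iff_complex]
    intro f
    have h2 : ⟪H f, f⟫ = ((∫ x, √x * ‖f x‖ ^ 2 ∂ρ : ℝ) : ℂ) := by
      rw [L2.inner_def, ← integral_complex_ofReal]
      refine integral_congr_ae ?_
      filter_upwards [hH f] with x hx
      rw [hx, RCLike.inner_apply, map_mul, Complex.conj_ofReal, mul_left_comm, Complex.mul_conj']
      push_cast
      rfl
    rw [h2]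
    exact ⟨rfl, integral_nonneg fun x => by positivity⟩
  have hHinj : ∀ f, H f = 0 → f = 0 := by
    intro f hf
    have h2 := hH f
    rw [hf] at h2
    refine Lp.ext ?_
    filter_upwards [h2, Lp.coeFn_zero ℂ 2 ρ, hnn, hne] with x hx hx0 hx1 hx2
    rw [hx0] at hx ⊢
    have h3 : (√x : ℂ) ≠ 0 :=
      Complex.ofReal_ne_zero.2 (Real.sqrt_pos.2 (lt_of_le_of_ne hx1 hx2.symm)).ne'
    exact (mul_eq_zero.1 hx.symm).resolve_left h3
  have hHH : ∀ f, H (H f) =ᵐ[ρ] fun x => (x : ℂ) * f x := by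
    intro f
    filter_upwards [hH (H f), hH f, hnn] with x hx1 hx2 hx3
    rw [hx1, hx2, ← mul_assoc, ← Complex.ofReal_mul, Real.mul_self_sqrt hx3]
  have hHpow : ∀ (n : ℕ) f, (H ^ (2 * n)) f =ᵐ[ρ] fun x => (x : ℂ) ^ n * f x := by
    intro n f
    induction n with
    | zero => simp
    | succ n ih =>
      have h2 : (H ^ (2 * (n + 1))) f = H (H ((H ^ (2 * n)) f)) := by
        rw [show 2 * (n + 1) = 2 * n + 1 + 1 by ring, pow_succ', pow_succ']
        rfl
      rw [h2]
      filter_upwards [hHH ((H ^ (2 * n)) f), ih] with x hx1 hx2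
      rw [hx1, hx2]
      ring
  have hcyc : ∀ f, (∀ n : ℕ, ⟪q, (H ^ n) f⟫ = 0) → f = 0 := by
    intro f hf
    refine Lp.ext ((ae_eq_zero_of_integral_pow_mul_eq_zero hC
      ((Lp.memLp f).integrable one_le_two) fun n => ?_).trans (Lp.coeFn_zero ℂ 2 ρ).symm)
    rw [← hf (2 * n), hqin]
    exact (integral_congr_ae (hHpow n f)).symm
  obtain ⟨α, Γ, ΓS, hmem, hres⟩ := exists_hankel_of_cyclic hHpos hHinj hq1 hcyc
  refine ⟨α, Γ, ΓS, hmem, fun z hz => ?_⟩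
  have hz0 : ∀ x : ℝ, 0 ≤ x → (x : ℂ) - z ≠ 0 := fun x hx => sub_ne_zero.2 (hz x hx).symm
  have hψ : MemLp (fun x : ℝ => ((x : ℂ) - z)⁻¹) ∞ ρ :=
    memLp_top_of_continuousOn_Icc hC (by fun_prop)
      (ContinuousOn.inv₀ (by fun_prop) fun x hx => hz0 x hx.1)
  set v : Lp ℂ 2 ρ := (hψ.mono_exponent le_top).toLp with hv
  have hvc : v =ᵐ[ρ] fun x => ((x : ℂ) - z)⁻¹ := MemLp.coeFn_toLp _
  rw [hres z hz v ?_, hqin]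
  · refine integral_congr_ae ?_
    filter_upwards [hHH v, hvc] with x hx1 hx2
    rw [hx1, hx2, div_eq_mul_inv]
  · refine Lp.ext ?_
    filter_upwards [Lp.coeFn_sub (H (H v)) (z • v), Lp.coeFn_smul z v, hHH v, hvc, hqc, hnn]
      with x hx1 hx2 hx3 hx4 hx5 hx6
    rw [hx1, Pi.sub_apply, hx2, Pi.smul_apply, hx3, hx4, hx5, smul_eq_mul, ← sub_mul,
      mul_inv_cancel₀ (hz0 x hx6)]
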